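/- Suppose k ≥ 2 and S is an optimal assignment map. Let h ≠ j ∈ {1,…,ℓ} with n_j ≤ n_h and let s ∈ {1,…,k} with S(h) = s. If for every i ≠ s with m(b_i) ≥ n_j one has ‖y_j − y_h‖ + (ρ_α(n_h + n_j, n_j)/ρ_α(m(b_s), n_j))·‖y_h − x_s‖ < ρ_α(m(b_i), n_j)·‖y_j − x_i‖, then S(j) = s. (Note m(b_s) ≥ n_h ≥ n_j since S(h) = s, so all occurrences of ρ_α are defined.) -/

import Mathlib

open scoped BigOperators RealInnerProductSpace

noncomputable section

attribute [local instance] Classical.propDecidable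

/-- Points of the ambient Euclidean space `ℝ^m`. -/
abbrev Pt (m : ℕ) := EuclideanSpace ℝ (Fin m)

/-- A weighted directed graph in `ℝ^m`: a finite vertex set, a finite set of
directed edges (ordered pairs of points, viewed as directed line segments), and
a weight function. -/
structure WDG (m : ℕ) where
  V : Finset (Pt m)
  E : Finset (Pt m × Pt m)
  w : Pt m × Pt m → ℝ

namespace WDG

variable {m : ℕ}

/-- Edges join distinct vertices of the graph and carry positive weight. -/
def edgesOK (G : WDG m) : Prop :=
  ∀ e ∈ G.E, e.1 ∈ G.V ∧ e.2 ∈ G.V ∧ e.1 ≠ e.2 ∧ 0 < G.w e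

/-- The underlying undirected (simple) graph. -/
def undirected (G : WDG m) : SimpleGraph (Pt m) :=
  SimpleGraph.fromRel (fun u v => (u, v) ∈ G.E)

/-- The cost `M_α(G) = Σ_{e ∈ E(G)} w(e)^α · length(e)`. -/
def cost (α : ℝ) (G : WDG m) : ℝ :=
  ∑ e ∈ G.E, (G.w e) ^ α * dist e.1 e.2

/-- Total weight of edges starting at `v`. -/
def outflow (G : WDG m) (v : Pt m) : ℝ :=
  ∑ e ∈ G.E.filter (fun e => e.1 = v), G.w e

/-- Total weight of edges ending at `v`. -/
def inflow (G : WDG m) (v : Pt m) : ℝ :=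
  ∑ e ∈ G.E.filter (fun e => e.2 = v), G.w e

end WDG

/-- Atomic measures are represented as finitely supported functions `ℝ^m →₀ ℝ`
with nonnegative values; `AtomicOn X c` also requires the atoms to lie in `X`. -/
def AtomicOn {m : ℕ} (X : Set (Pt m)) (c : Pt m →₀ ℝ) : Prop :=
  (∀ z, 0 ≤ c z) ∧ ↑c.support ⊆ X

/-- The mass `m(c)` of an atomic measure. -/
def massOf {m : ℕ} (c : Pt m →₀ ℝ) : ℝ := c.sum fun _ t => t

/-- `G` is a transport path from `a` to `b` inside `X`: its vertices lie in `X`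
and contain the atoms of `a` and `b`, its underlying undirected graph has no
cycles, and the balance equation holds at every vertex. -/
def IsTransportPath {m : ℕ} (X : Set (Pt m)) (G : WDG m) (a b : Pt m →₀ ℝ) : Prop :=
  G.edgesOK ∧ ↑G.V ⊆ X ∧
  (∀ z ∈ a.support, z ∈ G.V) ∧ (∀ z ∈ b.support, z ∈ G.V) ∧
  G.undirected.IsAcyclic ∧
  ∀ v : Pt m, G.outflow v - G.inflow v = a v - b v

/-- `d_α(a,b)`: the minimal cost of a transport path from `a` to `b`. -/
def dCost {m : ℕ} (X : Set (Pt m)) (α : ℝ) (a b : Pt m →₀ ℝ) : ℝ :=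
  sInf (WDG.cost α '' {G : WDG m | IsTransportPath X G a b})

/-- An optimal transport path from `a` to `b`. -/
def IsOptimalTP {m : ℕ} (X : Set (Pt m)) (α : ℝ) (G : WDG m) (a b : Pt m →₀ ℝ) : Prop :=
  IsTransportPath X G a b ∧
    ∀ G' : WDG m, IsTransportPath X G' a b → WDG.cost α G ≤ WDG.cost α G'

/-- The atomic probability measure `b = Σ_j n_j δ_{y_j}` of households. -/
def bMeas {m ℓ : ℕ} (y : Fin ℓ → Pt m) (n : Fin ℓ → ℝ) : Pt m →₀ ℝ :=
  ∑ j, Finsupp.single (y j) (n j)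

/-- An allocation path from the factory locations `x` to the households `(y,n)`:
a transport path to `b` from some atomic probability measure supported on the
factory locations. -/
def IsAllocPath {m k ℓ : ℕ} (X : Set (Pt m)) (x : Fin k → Pt m)
    (y : Fin ℓ → Pt m) (n : Fin ℓ → ℝ) (G : WDG m) : Prop :=
  ∃ a : Pt m →₀ ℝ, (∀ z, 0 ≤ a z) ∧ ↑a.support ⊆ Set.range x ∧ massOf a = 1 ∧
    IsTransportPath X G a (bMeas y n)

/-- An optimal allocation path: it minimizes `M_α` over all allocation paths. -/
def IsOptimalAllocPath {m k ℓ : ℕ} (X : Set (Pt m)) (α : ℝ) (x : Fin k → Pt m)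
    (y : Fin ℓ → Pt m) (n : Fin ℓ → ℝ) (G : WDG m) : Prop :=
  IsAllocPath X x y n G ∧
    ∀ G' : WDG m, IsAllocPath X x y n G' → WDG.cost α G ≤ WDG.cost α G'

/-- For an assignment map `S`, the part `b_i = Σ_{j : S(j) = i} n_j δ_{y_j}`. -/
def bPart {m k ℓ : ℕ} (y : Fin ℓ → Pt m) (n : Fin ℓ → ℝ) (S : Fin ℓ → Fin k)
    (i : Fin k) : Pt m →₀ ℝ :=
  ∑ j ∈ Finset.univ.filter (fun j => S j = i), Finsupp.single (y j) (n j)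

/-- The mass `m(b_i) = Σ_{j : S(j) = i} n_j`. -/
def mB {k ℓ : ℕ} (n : Fin ℓ → ℝ) (S : Fin ℓ → Fin k) (i : Fin k) : ℝ :=
  ∑ j ∈ Finset.univ.filter (fun j => S j = i), n j

/-- `E_α(S) = Σ_i d_α(m(b_i) δ_{x_i}, b_i)`. -/
def Ealpha {m k ℓ : ℕ} (X : Set (Pt m)) (α : ℝ) (x : Fin k → Pt m)
    (y : Fin ℓ → Pt m) (n : Fin ℓ → ℝ) (S : Fin ℓ → Fin k) : ℝ :=
  ∑ i, dCost X α (Finsupp.single (x i) (mB n S i)) (bPart y n S i)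

/-- An optimal assignment map minimizes `E_α` over all assignment maps. -/
def IsOptimalAssign {m k ℓ : ℕ} (X : Set (Pt m)) (α : ℝ) (x : Fin k → Pt m)
    (y : Fin ℓ → Pt m) (n : Fin ℓ → ℝ) (S : Fin ℓ → Fin k) : Prop :=
  ∀ S' : Fin ℓ → Fin k, Ealpha X α x y n S ≤ Ealpha X α x y n S'

/-- `ρ_α(σ,ε)`: equals `(σ/ε)^α − (σ/ε − 1)^α` for `σ > ε` (and for `σ = ε` when
`α ∈ (0,1)`), and equals `1` when `σ = ε` (covering also the convention for `α = 0`). -/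
def rho (α σ ε : ℝ) : ℝ :=
  if σ = ε then 1 else (σ / ε) ^ α - (σ / ε - 1) ^ α


/-- `G` is the disjoint union of the subgraphs `Gi`: the `Gi` have pairwise
disjoint vertex sets, each is a subgraph of `G` (with matching weights), and
the edges of `G` are exactly the (disjoint) union of their edges. -/
def IsDisjointUnion {m k : ℕ} (G : WDG m) (Gi : Fin k → WDG m) : Prop :=
  (∀ i i' : Fin k, i ≠ i' → Disjoint (Gi i).V (Gi i').V) ∧
  (∀ i, (Gi i).V ⊆ G.V) ∧
  (∀ i, (Gi i).E ⊆ G.E) ∧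
  (∀ i, ∀ e ∈ (Gi i).E, (Gi i).w e = G.w e) ∧
  G.E = Finset.univ.biUnion (fun i => (Gi i).E)

/-- The projection coordinate `π(z) = ⟨z − p, v⟩` along the line through `p`
in direction `v`. -/
def proj {m : ℕ} (p v z : Pt m) : ℝ := ⟪z - p, v⟫

/-- The constant `C = √(m−1)/(2^{1−(m−1)(1−α)} − 1) + 1`. -/
def Cconst (m : ℕ) (α : ℝ) : ℝ :=
  Real.sqrt ((m : ℝ) - 1) / ((2 : ℝ) ^ (1 - ((m : ℝ) - 1) * (1 - α)) - 1) + 1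


section Flows

variable {P : Type*}

/-- The cost per unit length `t ^ α` of an edge of weight `t`, with value `0` at `t = 0` even for
`α = 0`. -/
def edgeCost (α t : ℝ) : ℝ := if t = 0 then 0 else t ^ α

/-- The divergence of a finitely supported function on directed edges. -/
def boundary : (P × P →₀ ℝ) →ₗ[ℝ] (P →₀ ℝ) :=
  Finsupp.lmapDomain ℝ ℝ Prod.fst - Finsupp.lmapDomain ℝ ℝ Prod.snd

/-- A flow in `X` with divergence `c`. -/
def IsFlow (X : Set P) (f : P × P →₀ ℝ) (c : P →₀ ℝ) : Prop :=
  (∀ e, 0 ≤ f e) ∧ (∀ e ∈ f.support, e.1 ∈ X ∧ e.2 ∈ X) ∧ boundary f = c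

/-- No nonzero circulation is supported on the edges of `f`. -/
def CirculationFree (f : P × P →₀ ℝ) : Prop :=
  ∀ c : P × P →₀ ℝ, c.support ⊆ f.support → boundary c = 0 → c = 0

/-- The cost of a flow. -/
def flowCost [PseudoMetricSpace P] (α : ℝ) (f : P × P →₀ ℝ) : ℝ :=
  f.sum fun e t => edgeCost α t * dist e.1 e.2

@[simp] lemma edgeCost_zero (α : ℝ) : edgeCost α 0 = 0 := by simp [edgeCost]

lemma edgeCost_of_pos {α t : ℝ} (ht : 0 < t) : edgeCost α t = t ^ α := by
  simp [edgeCost, ht.ne']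

lemma edgeCost_nonneg {α t : ℝ} (ht : 0 ≤ t) : 0 ≤ edgeCost α t := by
  unfold edgeCost
  split_ifs
  · exact le_rfl
  · exact Real.rpow_nonneg ht _

lemma edgeCost_mono {α s t : ℝ} (hα : 0 ≤ α) (hs : 0 ≤ s) (hst : s ≤ t) :
    edgeCost α s ≤ edgeCost α t := by
  rcases hs.eq_or_lt with rfl | hs
  · simpa using edgeCost_nonneg hst
  · rw [edgeCost_of_pos hs, edgeCost_of_pos (hs.trans_le hst)]
    exact Real.rpow_le_rpow hs.le hst hα

lemma mul_edgeCost_le {α r t : ℝ} (hα : α ≤ 1) (hr : 0 < r) (hr1 : r ≤ 1) (ht : 0 ≤ t) :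
    r * edgeCost α t ≤ edgeCost α (r * t) := by
  rcases ht.eq_or_lt with rfl | ht
  · simp
  · rw [edgeCost_of_pos ht, edgeCost_of_pos (mul_pos hr ht), Real.mul_rpow hr.le ht.le]
    refine mul_le_mul_of_nonneg_right ?_ (Real.rpow_nonneg ht.le _)
    simpa using Real.rpow_le_rpow_of_exponent_ge hr hr1 hα

lemma concaveOn_edgeCost {α : ℝ} (hα0 : 0 ≤ α) (hα1 : α ≤ 1) :
    ConcaveOn ℝ (Set.Ici 0) (edgeCost α) := by
  refine ⟨convex_Ici 0, fun x hx y hy a b ha hb hab => ?_⟩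
  simp only [Set.mem_Ici, smul_eq_mul] at *
  rcases ha.eq_or_lt with rfl | ha
  · obtain rfl : b = 1 := by linarith
    simp
  rcases hb.eq_or_lt with rfl | hb
  · obtain rfl : a = 1 := by linarith
    simp
  rcases hx.eq_or_lt with rfl | hx
  · simpa using mul_edgeCost_le hα1 hb (by linarith) hy
  rcases hy.eq_or_lt with rfl | hy
  · simpa using mul_edgeCost_le hα1 ha (by linarith) hx.le
  have := (Real.concaveOn_rpow hα0 hα1).2 hx.le hy.le ha.le hb.le hab
  rw [edgeCost_of_pos hx, edgeCost_of_pos hy, edgeCost_of_pos (by positivity)]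
  simpa using this

/-- Removing mass `ε` from an edge saves less the larger the weight of the edge. -/
lemma edgeCost_sub_anti {α ε s t : ℝ} (hα0 : 0 ≤ α) (hα1 : α ≤ 1) (hε : 0 < ε) (hs : ε ≤ s)
    (hst : s ≤ t) :
    edgeCost α t - edgeCost α (t - ε) ≤ edgeCost α s - edgeCost α (s - ε) := by
  have hd : 0 < t - s + ε := by linarith
  have hc := (concaveOn_edgeCost hα0 hα1).2
  have h0 : (0 : ℝ) ≤ s - ε := by linarith
  have ht : (0 : ℝ) ≤ t := by linarith
  have ha : (0 : ℝ) ≤ (t - s) / (t - s + ε) := div_nonneg (by linarith) hd.le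
  have hb : (0 : ℝ) ≤ ε / (t - s + ε) := by positivity
  have hab : (t - s) / (t - s + ε) + ε / (t - s + ε) = 1 := by field_simp
  have h1 := hc h0 ht ha hb hab
  have h2 := hc h0 ht hb ha (by rw [add_comm, hab])
  simp only [smul_eq_mul] at h1 h2
  have e1 : (t - s) / (t - s + ε) * (s - ε) + ε / (t - s + ε) * t = s := by
    field_simp; ring
  have e2 : ε / (t - s + ε) * (s - ε) + (t - s) / (t - s + ε) * t = t - ε := by
    field_simp; ring
  rw [e1] at h1
  rw [e2] at h2
  have h3 : ((t - s) / (t - s + ε) + ε / (t - s + ε)) * edgeCost α (s - ε) +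
      ((t - s) / (t - s + ε) + ε / (t - s + ε)) * edgeCost α t ≤
      edgeCost α s + edgeCost α (t - ε) := by linarith
  rw [hab] at h3
  linarith

lemma edgeCost_add_le {α s t : ℝ} (hα0 : 0 ≤ α) (hα1 : α ≤ 1) (hs : 0 ≤ s) (ht : 0 ≤ t) :
    edgeCost α (s + t) ≤ edgeCost α s + edgeCost α t := by
  rcases ht.eq_or_lt with rfl | ht
  · simp
  have := edgeCost_sub_anti hα0 hα1 ht le_rfl (by linarith : t ≤ s + t)
  simp only [add_sub_cancel_right, sub_self, edgeCost_zero, sub_zero] at this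
  linarith

lemma edgeCost_sub_eq_rho {α σ ε : ℝ} (hε : 0 < ε) (hσ : ε ≤ σ) :
    edgeCost α σ - edgeCost α (σ - ε) = ε ^ α * rho α σ ε := by
  unfold rho
  split_ifs with h
  · subst h
    simp [edgeCost_of_pos hε]
  · have h1 : ε < σ := lt_of_le_of_ne hσ (Ne.symm h)
    have h2 : 0 < σ / ε - 1 := by rw [sub_pos, one_lt_div hε]; exact h1
    have h3 : 0 < σ / ε := by linarith
    rw [edgeCost_of_pos (hε.trans h1), edgeCost_of_pos (sub_pos.2 h1), mul_sub,
      ← Real.mul_rpow hε.le h3.le, ← Real.mul_rpow hε.le h2.le]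
    congr 2 <;> field_simp

lemma rho_pos {α σ ε : ℝ} (hα : 0 < α) (hε : 0 < ε) (hσ : ε ≤ σ) : 0 < rho α σ ε := by
  unfold rho
  split_ifs with h
  · exact one_pos
  · have h1 : ε < σ := lt_of_le_of_ne hσ (Ne.symm h)
    have h2 : 0 < σ / ε - 1 := by rw [sub_pos, one_lt_div hε]; exact h1
    exact sub_pos.2 (Real.rpow_lt_rpow h2.le (by linarith) hα)

lemma rho_zero_of_lt {σ ε : ℝ} (hσ : ε < σ) : rho 0 σ ε = 0 := by
  simp [rho, hσ.ne']

lemma boundary_single (u v : P) (t : ℝ) :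
    boundary (Finsupp.single (u, v) t) = Finsupp.single u t - Finsupp.single v t := by
  simp [boundary, Finsupp.mapDomain_single]

lemma boundary_pair (f : P × P →₀ ℝ) (ψ : P → ℝ) :
    (f.sum fun e t => t * (ψ e.1 - ψ e.2)) = (boundary f).sum fun v t => t * ψ v := by
  have key : (Finsupp.linearCombination ℝ fun e : P × P => ψ e.1 - ψ e.2) =
      (Finsupp.linearCombination ℝ ψ) ∘ₗ boundary := by
    ext ⟨u, v⟩
    simp [boundary_single]
  simpa [Finsupp.linearCombination_apply] using LinearMap.congr_fun key f

section Cost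

variable [PseudoMetricSpace P]

lemma flowCost_eq_sum (α : ℝ) {f : P × P →₀ ℝ} {F : Finset (P × P)} (h : f.support ⊆ F) :
    flowCost α f = ∑ e ∈ F, edgeCost α (f e) * dist e.1 e.2 :=
  Finsupp.sum_of_support_subset _ h _ (by simp)

lemma flowCost_add_single_le {α : ℝ} (hα0 : 0 ≤ α) (hα1 : α ≤ 1) {f : P × P →₀ ℝ}
    (hf : ∀ e, 0 ≤ f e) (u v : P) {t : ℝ} (ht : 0 < t) :
    flowCost α (f + Finsupp.single (u, v) t) ≤ flowCost α f + t ^ α * dist u v := by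
  have h1 : f.support ⊆ insert (u, v) f.support := Finset.subset_insert _ _
  have h2 : (f + Finsupp.single (u, v) t).support ⊆ insert (u, v) f.support := by
    intro e he
    by_contra hne
    simp only [Finset.mem_insert, Finsupp.mem_support_iff, not_or, not_not] at hne
    simp [hne.2, Finsupp.single_eq_of_ne hne.1] at he
  have h3 : t ^ α * dist u v = ∑ e ∈ insert (u, v) f.support,
      edgeCost α (Finsupp.single (u, v) t e) * dist e.1 e.2 := by
    rw [Finset.sum_eq_single (u, v)]
    · simp [edgeCost_of_pos ht]
    · intro e _ he
      simp [Finsupp.single_eq_of_ne he]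
    · simp
  rw [flowCost_eq_sum α h1, flowCost_eq_sum α h2, h3, ← Finset.sum_add_distrib]
  refine Finset.sum_le_sum fun e _ => ?_
  rw [← add_mul]
  refine mul_le_mul_of_nonneg_right ?_ dist_nonneg
  refine edgeCost_add_le hα0 hα1 (hf e) ?_
  rw [Finsupp.single_apply]
  split_ifs <;> linarith

end Cost

lemma exists_sub_smul_support_ssubset {f c : P × P →₀ ℝ} (hf : ∀ e, 0 ≤ f e)
    (hc : c.support ⊆ f.support) (hpos : ∃ e, 0 < c e) :
    ∃ t : ℝ, 0 < t ∧ (∀ e, 0 ≤ (f - t • c) e) ∧ (f - t • c).support ⊂ f.support := by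
  have hne : (c.support.filter fun e => 0 < c e).Nonempty := by
    obtain ⟨e, he⟩ := hpos
    exact ⟨e, by simp [he, he.ne']⟩
  obtain ⟨e₀, he₀, hmin⟩ := Finset.exists_min_image _ (fun e => f e / c e) hne
  simp only [Finset.mem_filter, Finsupp.mem_support_iff] at he₀ hmin
  have hf₀ : 0 < f e₀ :=
    lt_of_le_of_ne (hf e₀) (Ne.symm (by simpa using hc (by simp [he₀.1] : e₀ ∈ c.support)))
  refine ⟨f e₀ / c e₀, div_pos hf₀ he₀.2, fun e => ?_, ?_⟩
  · simp only [Finsupp.coe_sub, Finsupp.coe_smul, Pi.sub_apply, Pi.smul_apply, smul_eq_mul]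
    rcases lt_or_ge 0 (c e) with h | h
    · have := hmin e ⟨h.ne', h⟩
      rw [le_div_iff₀ h] at this
      linarith
    · have := mul_nonneg (div_pos hf₀ he₀.2).le (neg_nonneg.2 h)
      linarith [hf e]
  · refine Finset.ssubset_iff_subset_ne.2 ⟨fun e he => ?_, fun heq => ?_⟩
    · by_contra hfe
      have hce : c e = 0 := by
        by_contra h
        exact hfe (hc (by simpa using h))
      have hfe' : f e = 0 := by simpa using hfe
      simp [hfe', hce] at he
    · have : e₀ ∈ (f - (f e₀ / c e₀) • c).support := by rw [heq]; simpa using hf₀.ne'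
      simp [he₀.1] at this

variable [PseudoMetricSpace P]

lemma exists_smaller_support {α : ℝ} (hα0 : 0 ≤ α) (hα1 : α ≤ 1) {f c : P × P →₀ ℝ}
    (hf : ∀ e, 0 ≤ f e) (hc : c.support ⊆ f.support) (hpos : ∃ e, 0 < c e)
    (hb : boundary c = 0) :
    ∃ f' : P × P →₀ ℝ, (∀ e, 0 ≤ f' e) ∧ f'.support ⊂ f.support ∧
      boundary f' = boundary f ∧ flowCost α f' ≤ flowCost α f := by
  obtain ⟨t, ht, h0, hs⟩ := exists_sub_smul_support_ssubset hf hc hpos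
  by_cases hneg : ∃ e, c e < 0
  · obtain ⟨r, hr, h0', hs'⟩ := exists_sub_smul_support_ssubset (c := -c) hf
      (by simpa using hc) (by simpa using hneg)
    have hcost : r / (t + r) * flowCost α (f - t • c) + t / (t + r) * flowCost α (f - r • -c)
        ≤ flowCost α f := by
      rw [flowCost_eq_sum α hs.subset, flowCost_eq_sum α hs'.subset,
        flowCost_eq_sum α subset_rfl, Finset.mul_sum, Finset.mul_sum, ← Finset.sum_add_distrib]
      refine Finset.sum_le_sum fun e _ => ?_
      rw [← mul_assoc, ← mul_assoc, ← add_mul]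
      refine mul_le_mul_of_nonneg_right ?_ dist_nonneg
      have := (concaveOn_edgeCost hα0 hα1).2 (h0 e) (h0' e)
        (by positivity : 0 ≤ r / (t + r)) (by positivity : 0 ≤ t / (t + r)) (by field_simp; ring)
      simp only [smul_eq_mul] at this
      convert this using 2
      simp
      field_simp
      ring
    by_cases hle : flowCost α (f - t • c) ≤ flowCost α f
    · exact ⟨_, h0, hs, by simp [hb], hle⟩
    · refine ⟨_, h0', hs', by simp [hb], ?_⟩
      by_contra hlt
      push Not at hle hlt
      have h1 : r / (t + r) * flowCost α f < r / (t + r) * flowCost α (f - t • c) :=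
        mul_lt_mul_of_pos_left hle (by positivity)
      have h2 : t / (t + r) * flowCost α f < t / (t + r) * flowCost α (f - r • -c) :=
        mul_lt_mul_of_pos_left hlt (by positivity)
      have h3 : r / (t + r) * flowCost α f + t / (t + r) * flowCost α f = flowCost α f := by
        field_simp; ring
      linarith
  · push Not at hneg
    refine ⟨_, h0, hs, by simp [hb], ?_⟩
    rw [flowCost_eq_sum α hs.subset, flowCost_eq_sum α subset_rfl]
    refine Finset.sum_le_sum fun e _ => mul_le_mul_of_nonneg_right ?_ dist_nonneg
    refine edgeCost_mono hα0 (h0 e) ?_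
    simpa using mul_nonneg ht.le (hneg e)

/-- Every flow can be replaced by one without circulations at no greater cost. -/
lemma exists_circulationFree {α : ℝ} (hα0 : 0 ≤ α) (hα1 : α ≤ 1) {X : Set P}
    {f : P × P →₀ ℝ} {b : P →₀ ℝ} (hf : IsFlow X f b) :
    ∃ f', IsFlow X f' b ∧ CirculationFree f' ∧ flowCost α f' ≤ flowCost α f := by
  induction hN : f.support.card using Nat.strong_induction_on generalizing f with
  | _ N ih =>
    by_cases hfree : CirculationFree f
    · exact ⟨f, hf, hfree, le_rfl⟩
    simp only [CirculationFree, not_forall] at hfree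
    obtain ⟨c, hc, hb, hne⟩ := hfree
    obtain ⟨f', h0, hs, hb', hcost⟩ : ∃ f' : P × P →₀ ℝ, (∀ e, 0 ≤ f' e) ∧
        f'.support ⊂ f.support ∧ boundary f' = boundary f ∧ flowCost α f' ≤ flowCost α f := by
      obtain ⟨e, he⟩ := Finsupp.ne_iff.1 hne
      rcases lt_or_gt_of_ne he with h | h
      · exact exists_smaller_support (c := -c) hα0 hα1 hf.1 (by simpa using hc)
          ⟨e, by simpa using h⟩ (by simp [hb])
      · exact exists_smaller_support hα0 hα1 hf.1 hc ⟨e, h⟩ hb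
    obtain ⟨f'', h1, h2, h3⟩ := ih _ (hN ▸ Finset.card_lt_card hs)
      ⟨h0, fun e he => hf.2.1 e (hs.subset he), hb'.trans hf.2.2⟩ rfl
    exact ⟨f'', h1, h2, h3.trans hcost⟩

/-- The total length of a flow, counted with multiplicity. -/
def flowLength (g : P × P →₀ ℝ) : ℝ := g.sum fun e t => t * dist e.1 e.2

lemma flowLength_eq_sum {g : P × P →₀ ℝ} {F : Finset (P × P)} (h : g.support ⊆ F) :
    flowLength g = ∑ e ∈ F, g e * dist e.1 e.2 :=
  Finsupp.sum_of_support_subset _ h _ (by simp)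

lemma dist_le_flowLength {g : P × P →₀ ℝ} (hg : ∀ e, 0 ≤ g e) {x y : P}
    (hb : boundary g = Finsupp.single x 1 - Finsupp.single y 1) : dist x y ≤ flowLength g := by
  have h1 := boundary_pair g fun z => dist z y
  have h2 : ((boundary g).sum fun v t => t * dist v y) = dist x y := by
    have : ((boundary g).sum fun v t => t * dist v y) =
        Finsupp.linearCombination ℝ (fun v => dist v y) (boundary g) := by
      simp [Finsupp.linearCombination_apply]
    rw [this, hb]
    simp
  rw [← h2, ← h1]
  refine Finset.sum_le_sum fun e _ => mul_le_mul_of_nonneg_left ?_ (hg e)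
  linarith [dist_triangle e.1 e.2 y]

lemma flowCost_sub_smul_le {α : ℝ} (hα0 : 0 ≤ α) (hα1 : α ≤ 1) {f g : P × P →₀ ℝ} {ε M : ℝ}
    (hε : 0 < ε) (hεM : ε ≤ M) (hg : ∀ e, g e = 0 ∨ g e = 1) (hgf : ∀ e, ε * g e ≤ f e)
    (hs : g.support ⊆ f.support) (hfM : ∀ e, f e ≤ M) :
    flowCost α (f - ε • g) + ε ^ α * rho α M ε * flowLength g ≤ flowCost α f := by
  have hs' : (f - ε • g).support ⊆ f.support := fun e he => by
    by_contra hfe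
    have hge : e ∉ g.support := fun h => hfe (hs h)
    simp only [Finsupp.mem_support_iff, not_not] at hfe hge
    simp [hfe, hge] at he
  rw [flowCost_eq_sum α hs', flowCost_eq_sum α subset_rfl, flowLength_eq_sum hs,
    Finset.mul_sum, ← Finset.sum_add_distrib]
  refine Finset.sum_le_sum fun e _ => ?_
  rw [← mul_assoc, ← add_mul]
  refine mul_le_mul_of_nonneg_right ?_ dist_nonneg
  rcases hg e with h | h
  · simp [h]
  · have h1 : ε ≤ f e := by simpa [h] using hgf e
    have h2 := edgeCost_sub_anti hα0 hα1 hε h1 (hfM e)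
    rw [edgeCost_sub_eq_rho hε hεM] at h2
    simp only [Finsupp.coe_sub, Finsupp.coe_smul, Pi.sub_apply, Pi.smul_apply, smul_eq_mul, h,
      mul_one]
    linarith

lemma flowCost_add_smul_le {α : ℝ} (hα0 : 0 ≤ α) (hα1 : α ≤ 1) {f g : P × P →₀ ℝ} {ε σ : ℝ}
    (hε : 0 < ε) (hσ : 0 ≤ σ) (hg : ∀ e, g e = 0 ∨ g e = 1) (hgf : ∀ e, σ * g e ≤ f e)
    (hs : g.support ⊆ f.support) :
    flowCost α (f + ε • g) ≤ flowCost α f + ε ^ α * rho α (σ + ε) ε * flowLength g := by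
  have hs' : (f + ε • g).support ⊆ f.support := fun e he => by
    by_contra hfe
    have hge : e ∉ g.support := fun h => hfe (hs h)
    simp only [Finsupp.mem_support_iff, not_not] at hfe hge
    simp [hfe, hge] at he
  rw [flowCost_eq_sum α hs', flowCost_eq_sum α subset_rfl, flowLength_eq_sum hs,
    Finset.mul_sum, ← Finset.sum_add_distrib]
  refine Finset.sum_le_sum fun e _ => ?_
  rw [← mul_assoc, ← add_mul]
  refine mul_le_mul_of_nonneg_right ?_ dist_nonneg
  rcases hg e with h | h
  · simp [h]
  · have h1 : σ ≤ f e := by simpa [h] using hgf e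
    have h2 := edgeCost_sub_anti hα0 hα1 hε (by linarith : ε ≤ σ + ε)
      (by linarith : σ + ε ≤ f e + ε)
    have h3 := edgeCost_sub_eq_rho (α := α) hε (by linarith : ε ≤ σ + ε)
    simp only [Finsupp.coe_add, Finsupp.coe_smul, Pi.add_apply, Pi.smul_apply, smul_eq_mul, h,
      mul_one]
    simp only [add_sub_cancel_right] at h2 h3
    linarith

end Flows

section Decomposition

variable {P ι : Type*}

/-- A flow from a single source to several sinks contains a simple path to each of them. -/
lemma exists_unit_path {f : P × P →₀ ℝ} (hf : ∀ e, 0 ≤ f e) {x : P} {y : ι → P} {n : ι → ℝ}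
    {J : Finset ι} (hn : ∀ i ∈ J, 0 < n i)
    (hb : boundary f = Finsupp.single x (∑ i ∈ J, n i) - ∑ i ∈ J, Finsupp.single (y i) (n i))
    {j : ι} (hj : j ∈ J) :
    ∃ g : P × P →₀ ℝ, (∀ e, g e = 0 ∨ g e = 1) ∧ g.support ⊆ f.support ∧
      boundary g = Finsupp.single x 1 - Finsupp.single (y j) 1 := by
  let V : Finset P := insert x (f.support.image Prod.fst ∪ f.support.image Prod.snd)
  let good : Finset P → Prop := fun A => x ∈ A ∧ ∀ u ∈ A, ∃ g : P × P →₀ ℝ,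
    (∀ e, g e = 0 ∨ g e = 1) ∧ (∀ e ∈ g.support, e ∈ f.support ∧ e.2 ∈ A) ∧
      boundary g = Finsupp.single x 1 - Finsupp.single u 1
  have hgood : good {x} := by
    refine ⟨by simp, fun u hu => ⟨0, by simp, by simp, ?_⟩⟩
    rw [Finset.mem_singleton.1 hu]
    simp
  obtain ⟨A, hA, hmax⟩ := Finset.exists_max_image (V.powerset.filter good) Finset.card
    ⟨{x}, by simp [hgood, V]⟩
  simp only [Finset.mem_filter, Finset.mem_powerset] at hA hmax
  obtain ⟨hAV, hxA, hpaths⟩ := hA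
  have hclosed : ∀ e ∈ f.support, e.1 ∈ A → e.2 ∈ A := by
    rintro ⟨u, v⟩ he hu
    by_contra hv
    refine absurd (hmax (insert v A) ⟨?_, by simp [hxA], ?_⟩)
      (by rw [Finset.card_insert_of_notMem hv]; omega)
    · refine Finset.insert_subset ?_ hAV
      exact Finset.mem_insert_of_mem (Finset.mem_union_right _ (Finset.mem_image_of_mem _ he))
    · intro w hw
      rcases Finset.mem_insert.1 hw with rfl | hw
      · obtain ⟨g, h01, hs, hbg⟩ := hpaths u hu
        have hg0 : g (u, w) = 0 := by
          by_contra h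
          exact hv (hs (u, w) (by simpa using h)).2
        refine ⟨g + Finsupp.single (u, w) 1, fun e => ?_, fun e hes => ?_, ?_⟩
        · rcases eq_or_ne e (u, w) with rfl | hne
          · simp [hg0]
          · simpa [Finsupp.single_eq_of_ne hne] using h01 e
        · rcases eq_or_ne e (u, w) with rfl | hne
          · exact ⟨he, by simp⟩
          · have := hs e (by simpa [Finsupp.single_eq_of_ne hne] using hes)
            exact ⟨this.1, Finset.mem_insert_of_mem this.2⟩
        · rw [map_add, hbg, boundary_single]
          abel
      · obtain ⟨g, h01, hs, hbg⟩ := hpaths w hw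
        exact ⟨g, h01, fun e he => ⟨(hs e he).1, Finset.mem_insert_of_mem (hs e he).2⟩, hbg⟩
  have hyA : y j ∈ A := by
    by_contra hyA
    let ψ : P → ℝ := fun v => if v ∈ A then 1 else 0
    have h1 := boundary_pair f ψ
    have h2 : (f.sum fun e t => t * (ψ e.1 - ψ e.2)) ≤ 0 := by
      refine Finset.sum_nonpos fun e he => mul_nonpos_of_nonneg_of_nonpos (hf e) ?_
      by_cases h : e.1 ∈ A
      · simp [ψ, h, hclosed e he h]
      · simp only [ψ, h, if_false]
        split_ifs <;> norm_num
    have h3 : ((boundary f).sum fun v t => t * ψ v) = ∑ i ∈ J, n i * (1 - ψ (y i)) := by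
      have : ((boundary f).sum fun v t => t * ψ v) =
          Finsupp.linearCombination ℝ ψ (boundary f) := by
        simp [Finsupp.linearCombination_apply]
      rw [this, hb]
      simp [ψ, hxA, mul_sub, Finset.sum_sub_distrib]
    have h4 : n j * (1 - ψ (y j)) ≤ ∑ i ∈ J, n i * (1 - ψ (y i)) := by
      refine Finset.single_le_sum (f := fun i => n i * (1 - ψ (y i))) (fun i hi => ?_) hj
      refine mul_nonneg (hn i hi).le ?_
      simp only [ψ]
      split_ifs <;> norm_num
    have h5 : ψ (y j) = 0 := by simp [ψ, hyA]
    rw [h5] at h4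
    linarith [hn j hj]
  obtain ⟨g, h01, hs, hbg⟩ := hpaths _ hyA
  exact ⟨g, h01, fun e he => (hs e he).1, hbg⟩

/-- In a circulation-free flow from a single source, every sink is reached by a simple path
along which the flow is at least the mass of the sink. -/
lemma exists_heavy_path {f : P × P →₀ ℝ} (hf : ∀ e, 0 ≤ f e) (hfree : CirculationFree f) {x : P}
    {y : ι → P} {n : ι → ℝ} {J : Finset ι} (hn : ∀ i ∈ J, 0 < n i)
    (hb : boundary f = Finsupp.single x (∑ i ∈ J, n i) - ∑ i ∈ J, Finsupp.single (y i) (n i))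
    {j : ι} (hj : j ∈ J) :
    (∀ e, f e ≤ ∑ i ∈ J, n i) ∧ ∃ g : P × P →₀ ℝ, (∀ e, g e = 0 ∨ g e = 1) ∧
      g.support ⊆ f.support ∧ (∀ e, n j * g e ≤ f e) ∧
      boundary g = Finsupp.single x 1 - Finsupp.single (y j) 1 := by
  have hex : ∀ i, ∃ g : P × P →₀ ℝ, i ∈ J → (∀ e, g e = 0 ∨ g e = 1) ∧
      g.support ⊆ f.support ∧ boundary g = Finsupp.single x 1 - Finsupp.single (y i) 1 := by
    intro i
    by_cases hi : i ∈ J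
    · obtain ⟨g, hg⟩ := exists_unit_path hf hn hb hi
      exact ⟨g, fun _ => hg⟩
    · exact ⟨0, fun h => absurd h hi⟩
  choose g hg using hex
  have hzero : f - ∑ i ∈ J, n i • g i = 0 := by
    refine hfree _ (fun e he => ?_) ?_
    · by_contra hfe
      have h0 : ∀ i ∈ J, n i * g i e = 0 := fun i hi => by
        have : e ∉ (g i).support := fun h => hfe ((hg i hi).2.1 h)
        simp [Finsupp.notMem_support_iff.1 this]
      have h1 : f e = 0 := by simpa using hfe
      simp [h1, Finset.sum_eq_zero h0] at he
    · rw [map_sub, map_sum, hb, sub_eq_zero, sub_eq_iff_eq_add, ← Finset.sum_add_distrib,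
        Finsupp.single_finsetSum]
      refine Finset.sum_congr rfl fun i hi => ?_
      rw [map_smul, (hg i hi).2.2, smul_sub]
      simp
  have hfe : ∀ e, f e = ∑ i ∈ J, n i * g i e := fun e => by
    have := DFunLike.congr_fun (sub_eq_zero.1 hzero) e
    simpa [Finsupp.finsetSum_apply] using this
  have h01 : ∀ i ∈ J, ∀ e, 0 ≤ g i e ∧ g i e ≤ 1 := fun i hi e => by
    rcases (hg i hi).1 e with h | h <;> simp [h]
  refine ⟨fun e => ?_, g j, (hg j hj).1, (hg j hj).2.1, fun e => ?_, (hg j hj).2.2⟩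
  · rw [hfe]
    exact Finset.sum_le_sum fun i hi => mul_le_of_le_one_right (hn i hi).le (h01 i hi e).2
  · rw [hfe]
    exact Finset.single_le_sum (f := fun i => n i * g i e)
      (fun i hi => mul_nonneg (hn i hi).le (h01 i hi e).1) hj

end Decomposition

lemma support_single_subset_of_mem {P : Type*} {X : Set P} {x : P} (hx : x ∈ X) (t : ℝ) :
    ↑(Finsupp.single x t).support ⊆ X := fun z hz => by
  rwa [Finset.mem_singleton.1 (Finsupp.support_single_subset hz)]

lemma support_sum_single_subset {P ι : Type*} {X : Set P} {y : ι → P} (hy : ∀ i, y i ∈ X)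
    (n : ι → ℝ) (J : Finset ι) : ↑(∑ i ∈ J, Finsupp.single (y i) (n i)).support ⊆ X := by
  intro z hz
  by_contra hzX
  refine Finsupp.mem_support_iff.1 hz ?_
  rw [Finsupp.finsetSum_apply]
  refine Finset.sum_eq_zero fun i _ => Finsupp.single_eq_of_ne ?_
  rintro rfl
  exact hzX (hy i)

section TransportPaths

lemma boundary_apply {P : Type*} {f : P × P →₀ ℝ} {F : Finset (P × P)} (hF : f.support ⊆ F)
    (v : P) :
    boundary f v = ∑ e ∈ F with e.1 = v, f e - ∑ e ∈ F with e.2 = v, f e := by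
  have key (p : P × P → P) : f.mapDomain p v = ∑ e ∈ F with p e = v, f e := by
    rw [Finsupp.mapDomain, Finsupp.sum_apply, Finsupp.sum_of_support_subset _ hF _ (by simp),
      Finset.sum_filter]
    simp [Finsupp.single_apply]
  simp [boundary, key]

variable {m : ℕ}

/-- The flow carried by a weighted directed graph. -/
def WDG.toFlow (G : WDG m) : Pt m × Pt m →₀ ℝ :=
  Finsupp.onFinset G.E (fun e => if e ∈ G.E then G.w e else 0) (by simp +contextual)

lemma WDG.toFlow_apply (G : WDG m) {e : Pt m × Pt m} (he : e ∈ G.E) : G.toFlow e = G.w e := by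
  simp [WDG.toFlow, he]

lemma WDG.support_toFlow_subset (G : WDG m) : G.toFlow.support ⊆ G.E :=
  Finsupp.support_onFinset_subset

lemma WDG.isFlow_toFlow {G : WDG m} {X : Set (Pt m)} {a b : Pt m →₀ ℝ}
    (hG : IsTransportPath X G a b) : IsFlow X G.toFlow (a - b) := by
  obtain ⟨hE, hV, -, -, -, hbal⟩ := hG
  refine ⟨fun e => ?_, fun e he => ?_, ?_⟩
  · by_cases he : e ∈ G.E
    · rw [G.toFlow_apply he]
      exact (hE e he).2.2.2.le
    · simp [WDG.toFlow, he]
  · have := hE e (G.support_toFlow_subset he)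
    exact ⟨hV this.1, hV this.2.1⟩
  · ext v
    rw [boundary_apply G.support_toFlow_subset, Finsupp.sub_apply, ← hbal v, WDG.outflow,
      WDG.inflow]
    congr 1 <;>
      exact Finset.sum_congr (by congr) fun e he => G.toFlow_apply (Finset.mem_filter.1 he).1

lemma WDG.flowCost_toFlow {G : WDG m} (hG : G.edgesOK) (α : ℝ) :
    flowCost α G.toFlow = G.cost α := by
  rw [flowCost_eq_sum α G.support_toFlow_subset, WDG.cost]
  refine Finset.sum_congr rfl fun e he => ?_
  rw [G.toFlow_apply he, edgeCost_of_pos (hG e he).2.2.2]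

lemma WDG.cost_nonneg {G : WDG m} (hG : G.edgesOK) (α : ℝ) : 0 ≤ G.cost α :=
  Finset.sum_nonneg fun e he => mul_nonneg (Real.rpow_nonneg (hG e he).2.2.2.le _) dist_nonneg

/-- The chain carried by an undirected step along an edge of `E`. -/
def stepChain {P : Type*} (E : Finset (P × P)) (u v : P) : P × P →₀ ℝ :=
  if (u, v) ∈ E then Finsupp.single (u, v) 1 else -Finsupp.single (v, u) 1

lemma boundary_stepChain {P : Type*} (E : Finset (P × P)) (u v : P) :
    boundary (stepChain E u v) = Finsupp.single u 1 - Finsupp.single v 1 := by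
  unfold stepChain
  split_ifs <;> simp [boundary_single]

lemma exists_chain_of_walk {P : Type*} (E : Finset (P × P)) {u v : P}
    (p : (SimpleGraph.fromRel fun u v => (u, v) ∈ E).Walk u v) :
    ∃ c : P × P →₀ ℝ, c.support ⊆ E ∧
      boundary c = Finsupp.single u 1 - Finsupp.single v 1 ∧
      ∀ e, c e ≠ 0 → s(e.1, e.2) ∈ p.edges := by
  induction p with
  | nil => exact ⟨0, by simp, by simp, by simp⟩
  | @cons u v w h p ih =>
    obtain ⟨c, hs, hb, he⟩ := ih
    have hstep : ∀ e, stepChain E u v e ≠ 0 → e ∈ E ∧ s(e.1, e.2) = s(u, v) := by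
      intro e hne
      rw [SimpleGraph.fromRel_adj] at h
      unfold stepChain at hne
      split_ifs at hne with huv
      · obtain rfl : e = (u, v) := by
          by_contra h'
          exact hne (Finsupp.single_eq_of_ne h')
        exact ⟨huv, rfl⟩
      · obtain rfl : e = (v, u) := by
          by_contra h'
          exact hne (by simp [Finsupp.single_eq_of_ne h'])
        exact ⟨h.2.resolve_left huv, Sym2.eq_swap⟩
    have hor : ∀ e, (stepChain E u v + c) e ≠ 0 → stepChain E u v e ≠ 0 ∨ c e ≠ 0 := by
      intro e hne
      by_contra! h'
      exact hne (by simp [h'])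
    refine ⟨stepChain E u v + c, fun e hes => ?_, ?_, fun e hne => ?_⟩
    · rcases hor e (by simpa using hes) with h' | h'
      · exact (hstep e h').1
      · exact hs (by simpa using h')
    · rw [map_add, boundary_stepChain, hb]
      abel
    · rw [SimpleGraph.Walk.edges_cons, List.mem_cons]
      exact (hor e hne).imp (fun h' => (hstep e h').2) (he e)

lemma CirculationFree.isAcyclic {P : Type*} {f : P × P →₀ ℝ} (hf : CirculationFree f) :
    (SimpleGraph.fromRel fun u v => (u, v) ∈ f.support).IsAcyclic := by
  intro u p hp
  cases p with
  | nil => exact absurd hp (by simp)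
  | @cons _ v _ h p =>
    rw [SimpleGraph.Walk.cons_isCycle_iff] at hp
    obtain ⟨c₁, hs₁, hb₁, he₁⟩ := exists_chain_of_walk f.support (SimpleGraph.Walk.cons h .nil)
    obtain ⟨c₂, hs₂, hb₂, he₂⟩ := exists_chain_of_walk f.support p
    have hzero : c₁ + c₂ = 0 := by
      refine hf _ (Finsupp.support_add.trans (Finset.union_subset hs₁ hs₂)) ?_
      rw [map_add, hb₁, hb₂]
      abel
    have hc₁ : c₁ = 0 := by
      ext e
      by_contra hne
      have h₁ : s(e.1, e.2) = s(u, v) := by simpa using he₁ e hne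
      have h₂ : c₂ e ≠ 0 := fun h0 => hne (by simpa [h0] using DFunLike.congr_fun hzero e)
      exact hp.2 (h₁ ▸ he₂ e h₂)
    rw [hc₁, map_zero] at hb₁
    have := DFunLike.congr_fun hb₁ u
    have huv : v ≠ u := h.ne'
    simp [Finsupp.single_eq_of_ne huv.symm] at this

lemma dCost_bddBelow (X : Set (Pt m)) (α : ℝ) (a b : Pt m →₀ ℝ) :
    BddBelow (WDG.cost α '' {G : WDG m | IsTransportPath X G a b}) := by
  refine ⟨0, ?_⟩
  rintro _ ⟨G, hG, rfl⟩
  exact WDG.cost_nonneg hG.1 α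

/-- A circulation-free flow is the flow of a transport path of the same cost. -/
lemma exists_transportPath {X : Set (Pt m)} {f : Pt m × Pt m →₀ ℝ} {a b : Pt m →₀ ℝ}
    (ha : ↑a.support ⊆ X) (hb : ↑b.support ⊆ X) (hf : IsFlow X f (a - b))
    (hfree : CirculationFree f) (α : ℝ) :
    ∃ G : WDG m, IsTransportPath X G a b ∧ G.cost α = flowCost α f := by
  have hpos : ∀ e ∈ f.support, 0 < f e := fun e he =>
    lt_of_le_of_ne (hf.1 e) (Ne.symm (by simpa using he))
  refine ⟨⟨f.support.image Prod.fst ∪ f.support.image Prod.snd ∪ (a.support ∪ b.support),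
    f.support, f⟩, ⟨fun e he => ⟨?_, ?_, fun h => ?_, hpos e he⟩, ?_, ?_, ?_, hfree.isAcyclic,
    fun v => ?_⟩, ?_⟩
  · exact Finset.mem_union_left _ (Finset.mem_union_left _ (Finset.mem_image_of_mem _ he))
  · exact Finset.mem_union_left _ (Finset.mem_union_right _ (Finset.mem_image_of_mem _ he))
  · have h0 := hfree (Finsupp.single e 1) (fun e' he' => ?_) ?_
    · simp at h0
    · rw [Finset.mem_singleton.1 (Finsupp.support_single_subset he')]
      exact he
    · rw [← Prod.mk.eta (p := e), boundary_single, h, sub_self]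
  · intro v hv
    simp only [Finset.coe_union, Finset.coe_image, Set.mem_union, Set.mem_image] at hv
    rcases hv with (⟨e, he, rfl⟩ | ⟨e, he, rfl⟩) | h | h
    · exact (hf.2.1 e he).1
    · exact (hf.2.1 e he).2
    · exact ha h
    · exact hb h
  · exact fun z hz => Finset.mem_union_right _ (Finset.mem_union_left _ hz)
  · exact fun z hz => Finset.mem_union_right _ (Finset.mem_union_right _ hz)
  · rw [← Finsupp.sub_apply, ← hf.2.2, boundary_apply subset_rfl, WDG.outflow, WDG.inflow]
    congr!
  · rw [flowCost_eq_sum α subset_rfl, WDG.cost]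
    exact Finset.sum_congr rfl fun e he => by rw [edgeCost_of_pos (hpos e he)]

lemma dCost_le_flowCost {X : Set (Pt m)} {α : ℝ} (hα0 : 0 ≤ α) (hα1 : α ≤ 1)
    {f : Pt m × Pt m →₀ ℝ} {a b : Pt m →₀ ℝ} (ha : ↑a.support ⊆ X) (hb : ↑b.support ⊆ X)
    (hf : IsFlow X f (a - b)) : dCost X α a b ≤ flowCost α f := by
  obtain ⟨f', hf', hfree, hle⟩ := exists_circulationFree hα0 hα1 hf
  obtain ⟨G, hG, hcost⟩ := exists_transportPath ha hb hf' hfree α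
  refine le_trans (csInf_le (dCost_bddBelow X α a b) ⟨G, hG, rfl⟩) ?_
  rwa [hcost]

lemma exists_flowCost_lt {X : Set (Pt m)} {α : ℝ} (hα0 : 0 ≤ α) (hα1 : α ≤ 1)
    {f₀ : Pt m × Pt m →₀ ℝ} {a b : Pt m →₀ ℝ} (ha : ↑a.support ⊆ X) (hb : ↑b.support ⊆ X)
    (hf₀ : IsFlow X f₀ (a - b)) {δ : ℝ} (hδ : 0 < δ) :
    ∃ f, IsFlow X f (a - b) ∧ CirculationFree f ∧ flowCost α f < dCost X α a b + δ := by
  obtain ⟨f', hf', hfree, -⟩ := exists_circulationFree hα0 hα1 hf₀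
  obtain ⟨G, hG, -⟩ := exists_transportPath ha hb hf' hfree α
  obtain ⟨_, ⟨G', hG', rfl⟩, hlt⟩ := exists_lt_of_csInf_lt
    (⟨_, ⟨G, hG, rfl⟩⟩ : (WDG.cost α '' {G : WDG m | IsTransportPath X G a b}).Nonempty)
    (lt_add_of_pos_right _ hδ)
  obtain ⟨f, hf, hfree, hle⟩ := exists_circulationFree hα0 hα1 (WDG.isFlow_toFlow hG')
  rw [WDG.flowCost_toFlow hG'.1] at hle
  exact ⟨f, hf, hfree, hle.trans_lt hlt⟩

/-- Near-optimal flows from a single factory `x` to the households in `J`. -/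
lemma exists_near_optimal_flow {ι : Type*} {X : Set (Pt m)} {α : ℝ} (hα0 : 0 ≤ α) (hα1 : α ≤ 1)
    {x : Pt m} (hx : x ∈ X) {y : ι → Pt m} (hy : ∀ i, y i ∈ X) {n : ι → ℝ} (hn : ∀ i, 0 < n i)
    (J : Finset ι) {δ : ℝ} (hδ : 0 < δ) :
    ∃ f, IsFlow X f (Finsupp.single x (∑ i ∈ J, n i) - ∑ i ∈ J, Finsupp.single (y i) (n i)) ∧
      CirculationFree f ∧ flowCost α f <
        dCost X α (Finsupp.single x (∑ i ∈ J, n i)) (∑ i ∈ J, Finsupp.single (y i) (n i)) + δ := by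
  refine exists_flowCost_lt (f₀ := ∑ i ∈ J, Finsupp.single (x, y i) (n i)) hα0 hα1
    (support_single_subset_of_mem hx _) (support_sum_single_subset hy n J)
    ⟨fun e => ?_, fun e he => ?_, ?_⟩ hδ
  · rw [Finsupp.finsetSum_apply]
    refine Finset.sum_nonneg fun i _ => ?_
    rw [Finsupp.single_apply]
    split_ifs
    · exact (hn i).le
    · exact le_rfl
  · have := support_sum_single_subset (X := {e : Pt m × Pt m | e.1 ∈ X ∧ e.2 ∈ X})
      (fun i => ⟨hx, hy i⟩) n J he
    exact this
  · rw [map_sum, Finsupp.single_finsetSum, ← Finset.sum_sub_distrib]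
    exact Finset.sum_congr rfl fun i _ => boundary_single _ _ _

end TransportPaths

section Reassignment

variable {m : ℕ} {ι : Type*} {X : Set (Pt m)} {α : ℝ} {x : Pt m} {y : ι → Pt m} {n : ι → ℝ}
  {J : Finset ι} {h j : ι}

/-- Cost saved by no longer serving household `j` from the factory `x`. -/
lemma dCost_erase_add_le [DecidableEq ι] (hα0 : 0 ≤ α) (hα1 : α ≤ 1) (hx : x ∈ X)
    (hy : ∀ i, y i ∈ X) (hn : ∀ i, 0 < n i) (hj : j ∈ J) :
    dCost X α (Finsupp.single x (∑ i ∈ J.erase j, n i))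
        (∑ i ∈ J.erase j, Finsupp.single (y i) (n i)) +
      n j ^ α * rho α (∑ i ∈ J, n i) (n j) * dist x (y j) ≤
    dCost X α (Finsupp.single x (∑ i ∈ J, n i)) (∑ i ∈ J, Finsupp.single (y i) (n i)) := by
  have hjM : n j ≤ ∑ i ∈ J, n i := Finset.single_le_sum (fun i _ => (hn i).le) hj
  refine le_of_forall_pos_le_add fun δ hδ => ?_
  obtain ⟨f, hf, hfree, hcost⟩ := exists_near_optimal_flow hα0 hα1 hx hy hn J hδ
  obtain ⟨hfM, g, h01, hs, hgf, hbg⟩ := exists_heavy_path hf.1 hfree (fun i _ => hn i) hf.2.2 hj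
  have hg0 : ∀ e, 0 ≤ g e := fun e => by rcases h01 e with h | h <;> simp [h]
  have hsave := flowCost_sub_smul_le hα0 hα1 (hn j) hjM h01 hgf hs hfM
  have hlen := dist_le_flowLength hg0 hbg
  have hrho : 0 ≤ n j ^ α * rho α (∑ i ∈ J, n i) (n j) := by
    rw [← edgeCost_sub_eq_rho (hn j) hjM, sub_nonneg]
    exact edgeCost_mono hα0 (by linarith) (by linarith [hn j])
  have hflow : IsFlow X (f - n j • g) (Finsupp.single x (∑ i ∈ J.erase j, n i) -
      ∑ i ∈ J.erase j, Finsupp.single (y i) (n i)) := by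
    refine ⟨fun e => by simpa using hgf e, fun e he => hf.2.1 e ?_, ?_⟩
    · by_contra hfe
      have hge : e ∉ g.support := fun h => hfe (hs h)
      simp only [Finsupp.mem_support_iff, not_not] at hfe hge
      simp [hfe, hge] at he
    · rw [map_sub, map_smul, hf.2.2, hbg, ← Finset.add_sum_erase J _ hj,
        ← Finset.add_sum_erase J _ hj, Finsupp.single_add, smul_sub]
      simp only [Finsupp.smul_single, smul_eq_mul, mul_one]
      abel
  have hle := dCost_le_flowCost hα0 hα1 (support_single_subset_of_mem hx _)
    (support_sum_single_subset hy n _) hflow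
  have := mul_le_mul_of_nonneg_left hlen hrho
  linarith

/-- Length of a path to household `h` in a near-optimal flow. -/
lemma rho_mul_flowLength_le (hα0 : 0 ≤ α) (hα1 : α ≤ 1) (hx : x ∈ X) (hy : ∀ i, y i ∈ X)
    {f g : Pt m × Pt m →₀ ℝ} {M ε δ : ℝ} {b : Pt m →₀ ℝ} (hb : ↑b.support ⊆ X)
    (hε : 0 < ε) (hεM : ε ≤ M) (hf : IsFlow X f (Finsupp.single x M - b)) (hfM : ∀ e, f e ≤ M)
    (hcost : flowCost α f < dCost X α (Finsupp.single x M) b + δ)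
    (h01 : ∀ e, g e = 0 ∨ g e = 1) (hs : g.support ⊆ f.support) (hgf : ∀ e, ε * g e ≤ f e)
    (hbg : boundary g = Finsupp.single x 1 - Finsupp.single (y h) 1) :
    ε ^ α * rho α M ε * flowLength g ≤ ε ^ α * dist x (y h) + δ := by
  have hsave := flowCost_sub_smul_le hα0 hα1 hε hεM h01 hgf hs hfM
  have h0 : ∀ e, 0 ≤ (f - ε • g) e := fun e => by simpa using hgf e
  have hadd := flowCost_add_single_le hα0 hα1 h0 x (y h) hε
  have hflow : IsFlow X (f - ε • g + Finsupp.single (x, y h) ε) (Finsupp.single x M - b) := by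
    refine ⟨fun e => ?_, fun e he => ?_, ?_⟩
    · refine add_nonneg (h0 e) ?_
      rw [Finsupp.single_apply]
      split_ifs <;> linarith
    · by_cases hfe : e ∈ f.support
      · exact hf.2.1 e hfe
      · have hge : e ∉ g.support := fun h => hfe (hs h)
        obtain rfl : e = (x, y h) := by
          by_contra hne
          simp only [Finsupp.mem_support_iff, not_not] at hfe hge
          simp [hfe, hge, Finsupp.single_eq_of_ne hne] at he
        exact ⟨hx, hy h⟩
    · rw [map_add, map_sub, map_smul, hf.2.2, hbg, boundary_single, smul_sub]
      simp
  have hle := dCost_le_flowCost hα0 hα1 (support_single_subset_of_mem hx _) hb hflow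
  linarith

/-- Cost of additionally serving household `j` through household `h`. -/
lemma dCost_insert_le [DecidableEq ι] (hα0 : 0 ≤ α) (hα1 : α ≤ 1) (hx : x ∈ X)
    (hy : ∀ i, y i ∈ X) (hn : ∀ i, 0 < n i) (hh : h ∈ J) (hj : j ∉ J) (hjh : n j ≤ n h) :
    dCost X α (Finsupp.single x (∑ i ∈ insert j J, n i))
        (∑ i ∈ insert j J, Finsupp.single (y i) (n i)) ≤
    dCost X α (Finsupp.single x (∑ i ∈ J, n i)) (∑ i ∈ J, Finsupp.single (y i) (n i)) +
      n j ^ α * (dist (y h) (y j) +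
        rho α (n h + n j) (n j) / rho α (∑ i ∈ J, n i) (n j) * dist x (y h)) := by
  have hhM : n h ≤ ∑ i ∈ J, n i := Finset.single_le_sum (fun i _ => (hn i).le) hh
  have hjM : n j ≤ ∑ i ∈ J, n i := hjh.trans hhM
  set M := ∑ i ∈ J, n i with hM
  set q := rho α (n h + n j) (n j) / rho α M (n j) with hq
  have hrho : rho α (n h + n j) (n j) = q * rho α M (n j) ∧ 0 ≤ q := by
    rcases hα0.eq_or_lt with rfl | hα
    · simp [hq, rho_zero_of_lt (lt_add_of_pos_left (n j) (hn h))]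
    · have h1 := rho_pos hα (hn j) hjM
      exact ⟨(div_mul_cancel₀ _ h1.ne').symm,
        (div_pos (rho_pos hα (hn j) (by linarith [hn h])) h1).le⟩
  refine le_of_forall_pos_le_add fun η hη => ?_
  have hδ : 0 < η / (1 + q) := div_pos hη (by linarith [hrho.2])
  obtain ⟨f, hf, hfree, hcost⟩ := exists_near_optimal_flow hα0 hα1 hx hy hn J hδ
  obtain ⟨hfM, g, h01, hs, hgf, hbg⟩ := exists_heavy_path hf.1 hfree (fun i _ => hn i) hf.2.2 hh
  have hg0 : ∀ e, 0 ≤ g e := fun e => by rcases h01 e with h | h <;> simp [h]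
  have hlen := rho_mul_flowLength_le hα0 hα1 hx hy (support_sum_single_subset hy n J) (hn j) hjM
    hf hfM hcost h01 hs (fun e => (mul_le_mul_of_nonneg_right hjh (hg0 e)).trans (hgf e)) hbg
  have hadd := flowCost_add_smul_le hα0 hα1 (hn j) (hn h).le h01 hgf hs
  have h0 : ∀ e, 0 ≤ (f + n j • g) e := fun e =>
    add_nonneg (hf.1 e) (mul_nonneg (hn j).le (hg0 e))
  have hadd' := flowCost_add_single_le hα0 hα1 h0 (y h) (y j) (hn j)
  have hflow : IsFlow X (f + n j • g + Finsupp.single (y h, y j) (n j))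
      (Finsupp.single x (∑ i ∈ insert j J, n i) -
        ∑ i ∈ insert j J, Finsupp.single (y i) (n i)) := by
    refine ⟨fun e => ?_, fun e he => ?_, ?_⟩
    · refine add_nonneg (h0 e) ?_
      rw [Finsupp.single_apply]
      split_ifs
      · exact (hn j).le
      · exact le_rfl
    · by_cases hfe : e ∈ f.support
      · exact hf.2.1 e hfe
      · have hge : e ∉ g.support := fun h => hfe (hs h)
        obtain rfl : e = (y h, y j) := by
          by_contra hne
          simp only [Finsupp.mem_support_iff, not_not] at hfe hge
          simp [hfe, hge, Finsupp.single_eq_of_ne hne] at he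
        exact ⟨hy h, hy j⟩
    · rw [map_add, map_add, map_smul, hf.2.2, hbg, boundary_single, smul_sub,
        Finset.sum_insert hj, Finset.sum_insert hj, Finsupp.single_add]
      simp only [Finsupp.smul_single, smul_eq_mul, mul_one]
      abel
  have hle := dCost_le_flowCost hα0 hα1 (support_single_subset_of_mem hx _)
    (support_sum_single_subset hy n _) hflow
  have h1 := mul_le_mul_of_nonneg_left hlen hrho.2
  have h2 : η = η / (1 + q) + q * (η / (1 + q)) := by
    have : (1 + q) ≠ 0 := by linarith [hrho.2]
    field_simp
  rw [hrho.1] at hadd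
  nlinarith

end Reassignment

/-- If household `h` (with `n_j ≤ n_h`) is assigned to `s` and
for every `i ≠ s` with `m(b_i) ≥ n_j` one has
`‖y_j − y_h‖ + (ρ_α(n_h + n_j, n_j)/ρ_α(m(b_s), n_j)) ‖y_h − x_s‖ <
ρ_α(m(b_i), n_j) ‖y_j − x_i‖`, then `S(j) = s`. -/
theorem stmt_13 {m k ℓ : ℕ} (X : Set (Pt m)) (hXc : IsCompact X) (hXconv : Convex ℝ X)
    (α : ℝ) (hα0 : 0 ≤ α) (hα1 : α < 1)
    (x : Fin k → Pt m) (hxinj : Function.Injective x) (hxX : ∀ i, x i ∈ X)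
    (y : Fin ℓ → Pt m) (hyinj : Function.Injective y) (hyX : ∀ j, y j ∈ X)
    (n : Fin ℓ → ℝ) (hn : ∀ j, 0 < n j) (hnsum : ∑ j, n j = 1)
    (hk : 2 ≤ k) (S : Fin ℓ → Fin k) (hS : IsOptimalAssign X α x y n S)
    (h j : Fin ℓ) (hhj : h ≠ j) (hnjh : n j ≤ n h)
    (s : Fin k) (hSh : S h = s)
    (hineq : ∀ i : Fin k, i ≠ s → n j ≤ mB n S i →
      ‖y j - y h‖ +
          (rho α (n h + n j) (n j) / rho α (mB n S s) (n j)) * ‖y h - x s‖ <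
        rho α (mB n S i) (n j) * ‖y j - x i‖) :
    S j = s := by
  by_contra hne
  set J : Fin k → Finset (Fin ℓ) := fun i => Finset.univ.filter fun l => S l = i with hJ
  have hjJ : j ∈ J (S j) := by simp [hJ]
  have hhJ : h ∈ J s := by simp [hJ, hSh]
  have hjs : j ∉ J s := by simpa [hJ] using hne
  have hs' : (Finset.univ.filter fun l => Function.update S j s l = s) = insert j (J s) := by
    ext l
    rcases eq_or_ne l j with rfl | hl
    · simp
    · simp [hJ, hl]
  have hi' : (Finset.univ.filter fun l => Function.update S j s l = S j) = (J (S j)).erase j := by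
    ext l
    rcases eq_or_ne l j with rfl | hl
    · simp [Ne.symm hne]
    · simp [hJ, hl]
  have ho : ∀ i, i ≠ S j ∧ i ≠ s →
      (Finset.univ.filter fun l => Function.update S j s l = i) = J i := by
    rintro i ⟨h1, h2⟩
    ext l
    rcases eq_or_ne l j with rfl | hl
    · simp [hJ, h1.symm, h2.symm]
    · simp [hJ, hl]
  have hopt := hS (Function.update S j s)
  rw [← sub_nonneg, Ealpha, Ealpha, ← Finset.sum_sub_distrib,
    Fintype.sum_eq_add (S j) s hne fun i hi => by rw [mB, bPart, ho i hi, sub_eq_zero]; rfl] at hopt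
  have hm : ∀ i, mB n S i = ∑ l ∈ J i, n l := fun _ => rfl
  have hb : ∀ i, bPart y n S i = ∑ l ∈ J i, Finsupp.single (y l) (n l) := fun _ => rfl
  simp only [hm, hb] at hopt
  simp only [mB, bPart, hs', hi'] at hopt
  have hsave := dCost_erase_add_le hα0 hα1.le (hxX (S j)) hyX hn hjJ
  have hadd := dCost_insert_le hα0 hα1.le (hxX s) hyX hn hhJ hjs hnjh
  have hlt := hineq (S j) hne (Finset.single_le_sum (fun i _ => (hn i).le) hjJ)
  rw [← dist_eq_norm, ← dist_eq_norm, ← dist_eq_norm, dist_comm (y j), dist_comm (y h) (x s),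
    dist_comm (y j)] at hlt
  have hlt' := mul_lt_mul_of_pos_left hlt (Real.rpow_pos_of_pos (hn j) α)
  simp only [hm] at hlt'
  rw [← mul_assoc (n j ^ α) (rho _ _ _)] at hlt'
  linarith

end
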